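/- arXiv:1512.07126 — 2 statements merged into one kernel-verified Lean document; each statement's English description precedes it below -/
import Mathlib

section
/- Let P = {x ∈ ℝ^n : a_i·x ≤ b_i, i = 1, …, m} be a non-empty maximum non-redundant polyhedron with a_1, …, a_m ∈ ℝ^n, b ∈ ℝ^m, such that X = P ∩ ℤ^n is finite. Then there exist a'_1, …, a'_m ∈ ℝ^n and b' ∈ ℝ^m such that: (1) P' = {x : a'_i·x ≤ b'_i, i = 1, …, m} is bounded, int(P') ∩ ℤ^n = P ∩ ℤ^n, and P' has exactly one integer point in the relative interior of each of its m facets; (2) the set V = (P' \ P) ∩ ℤ^n is in convex position and |V| = m. -/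
open Pointwise

noncomputable section

/-- The set of lattice (integer) points in `ℝ^n`. -/
def lat (n : ℕ) : Set (Fin n → ℝ) := {x | ∀ j, ∃ z : ℤ, x j = (z : ℝ)}

/-- The polyhedron determined by the subsystem of `A x ≤ b` indexed by `I`. -/
def polyI {n m : ℕ} (A : Fin m → Fin n → ℝ) (b : Fin m → ℝ) (I : Set (Fin m)) :
    Set (Fin n → ℝ) := {x | ∀ i ∈ I, ∑ j, A i j * x j ≤ b i}

/-- The integer points of a set `S ⊆ ℝ^n`. -/
def intPts {n : ℕ} (S : Set (Fin n → ℝ)) : Set (Fin n → ℝ) := S ∩ lat n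

/-- `c` is a valid Helly-type bound for dimension `n` and `k` integer points:
any polyhedron with exactly `k` integer points has a subsystem of at most `c`
inequalities with exactly the same integer points. -/
def HellyBound (n k c : ℕ) : Prop :=
  ∀ (m : ℕ) (A : Fin m → Fin n → ℝ) (b : Fin m → ℝ),
    (intPts (polyI A b Set.univ)).Finite →
    (intPts (polyI A b Set.univ)).ncard = k →
    ∃ I : Finset (Fin m), I.card ≤ c ∧
      intPts (polyI A b (↑I : Set (Fin m))) = intPts (polyI A b Set.univ)

/-- The quantity `c(n,k)`: the least valid Helly-type bound. -/
def cnk (n k : ℕ) : ℕ := sInf {c | HellyBound n k c}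

/-- A set of points is in convex position if no point of it lies in the convex
hull of the others. -/
def ConvexPos {n : ℕ} (V : Set (Fin n → ℝ)) : Prop :=
  ∀ v ∈ V, v ∉ convexHull ℝ (V \ {v})

/-- `iconv V = conv(V) ∩ ℤ^n`. -/
def iconv {n : ℕ} (V : Set (Fin n → ℝ)) : Set (Fin n → ℝ) :=
  convexHull ℝ V ∩ lat n

/-- `ℓ(n,k)`: the smallest integer `s` such that every set `V ⊆ ℤ^n` in convex
position with `|V| = s` satisfies `|iconv(V) \ V| ≥ k`. -/
def ellnk (n k : ℕ) : ℕ :=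
  sInf {s | ∀ V : Set (Fin n → ℝ), V ⊆ lat n → ConvexPos V → V.Finite →
    V.ncard = s → k ≤ (iconv V \ V).ncard}

/-- The set of midpoints of `V` that are not in `V`. -/
def midpts {n : ℕ} (V : Set (Fin n → ℝ)) : Set (Fin n → ℝ) :=
  {p | ∃ x ∈ V, ∃ y ∈ V, p = (1/2 : ℝ) • (x + y)} \ V

/-- `μ_c(n,s)`: the minimum number of midpoints `|M(V)|` over all sets
`V ⊆ ℝ^n` in convex position with `|V| = s`. -/
def muc (n s : ℕ) : ℕ :=
  sInf {m | ∃ V : Set (Fin n → ℝ), ConvexPos V ∧ V.Finite ∧ V.ncard = s ∧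
    (midpts V).ncard = m}

/-- `α(n,k)`: the maximum cardinality of a set `V ⊆ ℤ^n` in convex position
with `|iconv(V) \ V| = k`. -/
def alphank (n k : ℕ) : ℕ :=
  sSup {m | ∃ V : Set (Fin n → ℝ), V ⊆ lat n ∧ ConvexPos V ∧ V.Finite ∧
    V.ncard = m ∧ (iconv V \ V).ncard = k}

/-- A system `A x ≤ b` is non-redundant if removing any single inequality
strictly increases the set of integer points. -/
def NonRedundant {n m : ℕ} (A : Fin m → Fin n → ℝ) (b : Fin m → ℝ) : Prop :=
  ∀ i : Fin m,
    intPts (polyI A b Set.univ) ⊂ intPts (polyI A b ({i}ᶜ : Set (Fin m)))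

/-- The set of lattice (integer) points in Euclidean space `ℝ^n`. -/
def latE (n : ℕ) : Set (EuclideanSpace ℝ (Fin n)) := {x | ∀ j, ∃ z : ℤ, x j = (z : ℝ)}

lemma lat_eq_range (n : ℕ) :
    lat n = Set.range (fun (z : Fin n → ℤ) => fun j => ((z j : ℤ) : ℝ)) := by
  ext x
  constructor
  · intro h
    choose z hz using h
    exact ⟨z, funext fun j => (hz j).symm⟩
  · rintro ⟨z, rfl⟩ j
    exact ⟨z j, rfl⟩

lemma lat_countable (n : ℕ) : (lat n).Countable := by
  rw [lat_eq_range]; exact Set.countable_range _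

lemma lat_add {n : ℕ} {x y : Fin n → ℝ} (hx : x ∈ lat n) (hy : y ∈ lat n) : x + y ∈ lat n := by
  intro j
  obtain ⟨a, ha⟩ := hx j
  obtain ⟨b, hb⟩ := hy j
  exact ⟨a + b, by simp [ha, hb]⟩

lemma lat_neg {n : ℕ} {x : Fin n → ℝ} (hx : x ∈ lat n) : -x ∈ lat n := by
  intro j
  obtain ⟨a, ha⟩ := hx j
  exact ⟨-a, by simp [ha]⟩

lemma lat_sub {n : ℕ} {x y : Fin n → ℝ} (hx : x ∈ lat n) (hy : y ∈ lat n) : x - y ∈ lat n := by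
  rw [sub_eq_add_neg]; exact lat_add hx (lat_neg hy)

lemma box_finite (n N : ℕ) : (lat n ∩ {x | ∀ j, |x j| ≤ N}).Finite := by
  refine ((Set.finite_Icc (fun _ : Fin n => -(N : ℤ)) (fun _ => (N : ℤ))).image
    (fun (z : Fin n → ℤ) => fun j => ((z j : ℤ) : ℝ))).subset ?_
  rintro x ⟨hx, hb⟩
  rw [lat_eq_range] at hx
  obtain ⟨z, rfl⟩ := hx
  refine ⟨z, ⟨fun j => ?_, fun j => ?_⟩, rfl⟩
  · have := (abs_le.1 (hb j)).1
    simp only at this ⊢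
    exact_mod_cast this
  · have := (abs_le.1 (hb j)).2
    simp only at this ⊢
    exact_mod_cast this

lemma generic_exists (n : ℕ) :
    ∃ g : Fin n → ℝ, ∀ z ∈ lat n, z ≠ 0 → g ⬝ᵥ z ≠ 0 := by
  have htr : Transcendental ℤ (liouvilleNumber 2) :=
    transcendental_liouvilleNumber (m := 2) le_rfl
  refine ⟨fun j => (liouvilleNumber 2) ^ (j : ℕ), ?_⟩
  intro z hz hz0 h
  rw [lat_eq_range] at hz
  obtain ⟨z, rfl⟩ := hz
  apply hz0
  let p : Polynomial ℤ := ∑ j : Fin n, Polynomial.C (z j) * Polynomial.X ^ (j : ℕ)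
  have hp : Polynomial.aeval (liouvilleNumber 2) p = 0 := by
    simp only [p, map_sum, map_mul, map_pow, Polynomial.aeval_X, Polynomial.aeval_C]
    rw [← h]
    simp [dotProduct, mul_comm]
  have hp0 : p = 0 := by
    by_contra hne
    exact htr ⟨p, hne, hp⟩
  funext j
  have h1 : p.coeff j = z j := by
    simp only [p, Polynomial.finsetSum_coeff, Polynomial.coeff_C_mul, Polynomial.coeff_X_pow]
    rw [Finset.sum_eq_single j]
    · simp
    · intro k _ hk
      have : (j : ℕ) ≠ k := fun h => hk (Fin.ext h.symm)
      simp [this]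
    · simp
  rw [hp0] at h1
  simp only [Polynomial.coeff_zero] at h1
  simp [← h1]

lemma perturb {n : ℕ} (a : Fin n → ℝ) (β : ℝ) (F : Set (Fin n → ℝ)) (hF : F.Finite) :
    ∃ (c : Fin n → ℝ) (d : ℝ), (∀ z ∈ lat n, z ≠ 0 → c ⬝ᵥ z ≠ 0) ∧
      ∀ z ∈ F, (a ⬝ᵥ z ≤ β → c ⬝ᵥ z < d) ∧ (β < a ⬝ᵥ z → d < c ⬝ᵥ z) := by
  obtain ⟨g, hg⟩ := generic_exists n
  have h1 : ∃ d, β < d ∧ ∀ z ∈ F, β < a ⬝ᵥ z → d < a ⬝ᵥ z := by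
    have : ∀ᶠ d in nhdsWithin β (Set.Ioi β), ∀ z ∈ F, β < a ⬝ᵥ z → d < a ⬝ᵥ z := by
      rw [Filter.eventually_all_finite hF]
      intro z _
      by_cases h : β < a ⬝ᵥ z
      · filter_upwards [Ioo_mem_nhdsGT h] with d hd _ using hd.2
      · exact Filter.Eventually.of_forall fun d h' => absurd h' h
    obtain ⟨d, h, h'⟩ := (this.and self_mem_nhdsWithin).exists
    exact ⟨d, h', h⟩
  obtain ⟨d, hd, hdF⟩ := h1
  have hU : ∀ᶠ ε in nhds (0 : ℝ), ∀ z ∈ F, (a ⬝ᵥ z ≤ β → (a + ε • g) ⬝ᵥ z < d) ∧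
      (β < a ⬝ᵥ z → d < (a + ε • g) ⬝ᵥ z) := by
    rw [Filter.eventually_all_finite hF]
    intro z hz
    have hc : Filter.Tendsto (fun ε : ℝ => (a + ε • g) ⬝ᵥ z) (nhds 0) (nhds (a ⬝ᵥ z)) := by
      have : Continuous (fun ε : ℝ => (a + ε • g) ⬝ᵥ z) := by
        simp only [add_dotProduct, smul_dotProduct, smul_eq_mul]; fun_prop
      simpa using this.tendsto 0
    by_cases h : β < a ⬝ᵥ z
    · filter_upwards [hc.eventually (lt_mem_nhds (hdF z hz h))] with ε hε
      exact ⟨fun h' => absurd h (not_lt.2 h'), fun _ => hε⟩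
    · filter_upwards [hc.eventually (gt_mem_nhds (lt_of_le_of_lt (not_lt.1 h) hd))] with ε hε
      exact ⟨fun _ => hε, fun h' => absurd h' h⟩
  have hS : (⋃ z ∈ lat n, {ε : ℝ | z ≠ 0 ∧ (a + ε • g) ⬝ᵥ z = 0}).Countable := by
    refine (lat_countable n).biUnion fun z hz => Set.Subsingleton.countable ?_
    rintro e ⟨h0, he⟩ e' ⟨_, he'⟩
    simp only [add_dotProduct, smul_dotProduct, smul_eq_mul] at he he'
    have : (e - e') * (g ⬝ᵥ z) = 0 := by linarith
    rcases mul_eq_zero.1 this with h | h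
    · linarith
    · exact absurd h (hg z hz h0)
  obtain ⟨ε, hε, hεU⟩ := (hS.dense_compl ℝ).inter_nhds_nonempty hU
  refine ⟨a + ε • g, d, ?_, hεU⟩
  intro z hz h0 h
  apply hε
  simp only [Set.mem_iUnion]
  exact ⟨z, hz, h0, h⟩

lemma expand {n m : ℕ} (F : Set (Fin n → ℝ)) (hF : F.Finite) (c : Fin m → Fin n → ℝ)
    (d : Fin m → ℝ)
    (hw : ∀ i, ∃ w ∈ F, (∀ k, k ≠ i → c k ⬝ᵥ w < d k) ∧ d i ≤ c i ⬝ᵥ w) (J : Finset (Fin m)) :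
    ∃ d' : Fin m → ℝ, (∀ k, d k ≤ d' k) ∧
      (∀ i, ∃ w ∈ F, (∀ k, k ≠ i → c k ⬝ᵥ w < d' k) ∧ d' i ≤ c i ⬝ᵥ w ∧
        (i ∈ J → c i ⬝ᵥ w = d' i)) ∧
      (∀ z ∈ F, (∀ k, c k ⬝ᵥ z < d' k) → ∀ k, c k ⬝ᵥ z < d k) := by
  classical
  induction J using Finset.induction_on with
  | empty =>
    refine ⟨d, fun _ => le_rfl, fun i => ?_, fun z _ h => h⟩
    obtain ⟨w, h1, h2, h3⟩ := hw i
    exact ⟨w, h1, h2, h3, by simp⟩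
  | insert i J hi ih =>
    obtain ⟨d', h1, h2, h3⟩ := ih
    have hG : {z ∈ F | (∀ k, k ≠ i → c k ⬝ᵥ z < d' k) ∧ d' i ≤ c i ⬝ᵥ z}.Finite :=
      hF.subset (Set.sep_subset _ _)
    obtain ⟨w0, hw0F, hw0, hw0', _⟩ := h2 i
    obtain ⟨v, ⟨hvF, hv1, hv2⟩, hvmin⟩ :=
      Set.exists_min_image _ (fun z => c i ⬝ᵥ z) hG ⟨w0, hw0F, hw0, hw0'⟩
    have hle : ∀ k, d' k ≤ Function.update d' i (c i ⬝ᵥ v) k := by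
      intro k
      by_cases hk : k = i
      · subst hk; simpa using hv2
      · simp [hk]
    refine ⟨Function.update d' i (c i ⬝ᵥ v), fun k => (h1 k).trans (hle k), ?_, ?_⟩
    · intro k
      by_cases hk : k = i
      · subst hk
        refine ⟨v, hvF, fun l hl => ?_, by simp, by simp⟩
        simpa [hl] using hv1 l hl
      · obtain ⟨w, hwF, hw1, hw2, hw3⟩ := h2 k
        refine ⟨w, hwF, fun l hl => (hw1 l hl).trans_le (hle l), by simpa [hk] using hw2, ?_⟩
        intro hkJ
        simpa [hk] using hw3 ((Finset.mem_insert.1 hkJ).resolve_left hk)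
    · intro z hz hzs
      apply h3 z hz
      have hz1 : ∀ k, k ≠ i → c k ⬝ᵥ z < d' k := by
        intro k hk
        simpa [hk] using hzs k
      intro k
      by_cases hk : k = i
      · subst hk
        by_contra hcon
        have := hvmin z ⟨hz, hz1, not_lt.1 hcon⟩
        have h' := hzs k
        simp only [Function.update_self] at h'
        exact absurd h' (not_lt.2 this)
      · exact hz1 k hk

lemma remove {n m : ℕ} (X : Set (Fin n → ℝ))
    (hmax : ∀ (m' : ℕ) (A' : Fin m' → Fin n → ℝ) (b' : Fin m' → ℝ),
      NonRedundant A' b' → intPts (polyI A' b' Set.univ) = X → m' ≤ m)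
    {ι : Type} [Fintype ι] (C : ι → Fin n → ℝ) (e : ι → ℝ)
    (hX : {z ∈ lat n | ∀ i, C i ⬝ᵥ z ≤ e i} = X)
    (J : Finset ι) (hJ : J.card = m)
    (hw : ∀ i ∈ J, ∃ w ∈ lat n, w ∉ X ∧ ∀ k, k ≠ i → C k ⬝ᵥ w ≤ e k) :
    {z ∈ lat n | ∀ i ∈ J, C i ⬝ᵥ z ≤ e i} = X := by
  classical
  have hex : ∃ I : Finset ι, Minimal
      (fun I : Finset ι => {z ∈ lat n | ∀ i ∈ I, C i ⬝ᵥ z ≤ e i} = X) I := by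
    have := Set.Finite.exists_minimal (α := Finset ι)
      (s := {I : Finset ι | {z ∈ lat n | ∀ i ∈ I, C i ⬝ᵥ z ≤ e i} = X})
      (Set.toFinite _) ⟨Finset.univ, by simpa using hX⟩
    exact this
  obtain ⟨I, hI, hmin⟩ := hex
  simp only at hI hmin
  have hJI : J ⊆ I := by
    intro i hi
    by_contra hiI
    obtain ⟨w, hwl, hwX, hwk⟩ := hw i hi
    apply hwX
    rw [← hI]
    refine ⟨hwl, fun k hk => hwk k ?_⟩
    rintro rfl
    exact hiI hk
  have hcard : I.card ≤ m := by
    let eq := I.equivFin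
    have hXI : intPts (polyI (fun i => C (eq.symm i)) (fun i => e (eq.symm i)) Set.univ) = X := by
      rw [← hI]
      ext z
      constructor
      · rintro ⟨h1, h2⟩
        refine ⟨h2, fun i hi => ?_⟩
        have := h1 (eq ⟨i, hi⟩) trivial
        simp only [Equiv.symm_apply_apply] at this
        exact this
      · rintro ⟨h1, h2⟩
        exact ⟨fun i _ => h2 _ (eq.symm i).2, h1⟩
    refine hmax I.card (fun i => C (eq.symm i)) (fun i => e (eq.symm i)) ?_ hXI
    intro i
    refine ⟨fun z hz => ⟨fun k _ => hz.1 k trivial, hz.2⟩, fun hsub => ?_⟩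
    rw [hXI] at hsub
    have herase : {z ∈ lat n | ∀ k ∈ I.erase (eq.symm i : ι), C k ⬝ᵥ z ≤ e k} = X := by
      apply Set.Subset.antisymm
      · rintro z ⟨h1, h2⟩
        apply hsub
        refine ⟨fun k hk => h2 _ ?_, h1⟩
        refine Finset.mem_erase.2 ⟨?_, (eq.symm k).2⟩
        intro h
        apply hk
        exact eq.symm.injective (Subtype.ext h)
      · intro z hz
        rw [← hI] at hz
        exact ⟨hz.1, fun k hk => hz.2 k (Finset.mem_of_mem_erase hk)⟩
    have := hmin herase (Finset.erase_subset _ _) (eq.symm i).2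
    exact Finset.notMem_erase _ _ this
  rw [Finset.eq_of_subset_of_card_le hJI (by omega)]
  exact hI

lemma dirichlet {n : ℕ} (u : Fin n → ℝ) (ε : ℝ) (hε : 0 < ε) (T : ℝ) :
    ∃ z ∈ lat n, ∃ t : ℝ, T ≤ t ∧ ‖z - t • u‖ < ε := by
  let S := max T 0
  have hS : 0 ≤ S := le_max_right _ _
  let f : ℕ → Fin n → ℝ := fun k j => Int.fract ((k : ℝ) * S * u j)
  have hf : ∀ k, f k ∈ Set.Icc (0 : Fin n → ℝ) 1 := fun k =>
    ⟨fun j => Int.fract_nonneg _, fun j => (Int.fract_lt_one _).le⟩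
  obtain ⟨a, _, φ, hφ, hlim⟩ := isCompact_Icc.tendsto_subseq hf
  have hc := hlim.cauchySeq
  obtain ⟨N, hN⟩ := Metric.cauchySeq_iff.1 hc ε hε
  have hd := hN N le_rfl (N + 1) (Nat.le_succ N)
  have hlt : φ N + 1 ≤ φ (N + 1) := hφ (Nat.lt_succ_self N)
  refine ⟨fun j => ((⌊(φ (N+1) : ℝ) * S * u j⌋ - ⌊(φ N : ℝ) * S * u j⌋ : ℤ) : ℝ),
    fun j => ⟨_, rfl⟩, ((φ (N+1) : ℝ) - φ N) * S, ?_, ?_⟩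
  · have h1 : (1 : ℝ) ≤ (φ (N+1) : ℝ) - φ N := by
      have : ((φ N + 1 : ℕ) : ℝ) ≤ φ (N + 1) := by exact_mod_cast hlt
      push_cast at this
      linarith
    calc T ≤ S := le_max_left _ _
      _ = 1 * S := (one_mul _).symm
      _ ≤ _ := mul_le_mul_of_nonneg_right h1 hS
  · rw [dist_eq_norm] at hd
    refine lt_of_eq_of_lt (congrArg norm ?_) hd
    funext j
    simp only [Pi.sub_apply, Pi.smul_apply, smul_eq_mul, Function.comp, f, Int.fract, Int.cast_sub]
    ring

lemma dot_bound {n : ℕ} (c x : Fin n → ℝ) : |c ⬝ᵥ x| ≤ (∑ j, |c j|) * ‖x‖ := by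
  rw [Finset.sum_mul]
  refine (Finset.abs_sum_le_sum_abs _ _).trans (Finset.sum_le_sum fun j _ => ?_)
  rw [abs_mul]
  exact mul_le_mul_of_nonneg_left (norm_le_pi_norm x j) (abs_nonneg _)

/-- Approximation of a recession direction by lattice vectors. -/
lemma rec_approx {n m : ℕ} (c : Fin m → Fin n → ℝ)
    (hgen : ∀ i, ∀ z ∈ lat n, z ≠ 0 → c i ⬝ᵥ z ≠ 0)
    (u : Fin n → ℝ) (hu0 : ‖u‖ = 1) (hu : ∀ k, c k ⬝ᵥ u ≤ 0) (i : Fin m)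
    (hi : c i ⬝ᵥ u < 0 ∨ ∀ k, c k ⬝ᵥ u = 0) (ε : ℝ) (hε : 0 < ε) (T : ℝ) :
    ∃ z ∈ lat n, T ≤ ‖z‖ ∧ c i ⬝ᵥ z < 0 ∧ ∀ k, c k ⬝ᵥ z < ε := by
  let K : ℝ := 1 + ∑ k, ∑ j, |c k j|
  have hK : 0 < K := by positivity
  have hKk : ∀ k x, |c k ⬝ᵥ x| ≤ K * ‖x‖ := by
    intro k x
    refine (dot_bound _ _).trans (mul_le_mul_of_nonneg_right ?_ (norm_nonneg _))
    have := Finset.single_le_sum (f := fun k => ∑ j, |c k j|)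
      (fun k _ => Finset.sum_nonneg fun j _ => abs_nonneg _) (Finset.mem_univ k)
    linarith
  let δ := min 1 (ε / K)
  have hδ : 0 < δ := lt_min one_pos (div_pos hε hK)
  have hδK : K * δ ≤ ε := by
    have : δ ≤ ε / K := min_le_right _ _
    rw [le_div_iff₀ hK] at this
    linarith
  have hδ1 : δ ≤ 1 := min_le_left _ _
  have key : ∀ T' : ℝ, ∃ z ∈ lat n, ∃ t : ℝ, T' ≤ t ∧ 0 ≤ t ∧ 1 ≤ ‖z‖ ∧ T ≤ ‖z‖ ∧
      ∀ k, |c k ⬝ᵥ z - t * (c k ⬝ᵥ u)| < ε := by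
    intro T'
    obtain ⟨z, hz, t, ht, hzt⟩ := dirichlet u δ hδ (max (max T' 0) (max T 1 + 1))
    have h1 : T' ≤ t := ((le_max_left _ _).trans (le_max_left _ _)).trans ht
    have h2 : 0 ≤ t := ((le_max_right _ _).trans (le_max_left _ _)).trans ht
    have h3 : max T 1 + 1 ≤ t := (le_max_right _ _).trans ht
    have h4 : t - 1 ≤ ‖z‖ := by
      have : ‖t • u‖ ≤ ‖z‖ + ‖z - t • u‖ := by
        have := norm_sub_le z (z - t • u)
        simpa using this
      rw [norm_smul, hu0, Real.norm_of_nonneg h2] at this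
      linarith
    refine ⟨z, hz, t, h1, h2, ?_, ?_, ?_⟩
    · have := le_max_right T 1; linarith
    · have := le_max_left T 1; linarith
    · intro k
      have := hKk k (z - t • u)
      rw [dotProduct_sub, dotProduct_smul, smul_eq_mul] at this
      refine this.trans_lt (lt_of_lt_of_le (mul_lt_mul_of_pos_left hzt hK) hδK)
  rcases hi with hi | hi
  · obtain ⟨z, hz, t, ht, ht0, _, hzT, hk⟩ := key (ε / (-(c i ⬝ᵥ u)))
    refine ⟨z, hz, hzT, ?_, ?_⟩
    · rw [div_le_iff₀ (by linarith)] at ht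
      have := (abs_lt.1 (hk i)).2
      linarith
    · intro k
      have := (abs_lt.1 (hk k)).2
      have := mul_nonpos_of_nonneg_of_nonpos ht0 (hu k)
      linarith
  · obtain ⟨z, hz, t, ht, ht0, hz1, hzT, hk⟩ := key 0
    simp only [hi, mul_zero, sub_zero] at hk
    have hz0 : z ≠ 0 := by
      rintro rfl
      simp at hz1
      linarith
    rcases lt_or_gt_of_ne (hgen i z hz hz0) with h | h
    · exact ⟨z, hz, hzT, h, fun k => (abs_lt.1 (hk k)).2⟩
    · refine ⟨-z, lat_neg hz, by simpa using hzT, by simpa using h, fun k => ?_⟩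
      have := (abs_lt.1 (hk k)).1
      rw [dotProduct_neg]
      linarith

lemma bounded_of_no_rec {n m : ℕ} (c : Fin m → Fin n → ℝ) (d : Fin m → ℝ)
    (h : ∀ u : Fin n → ℝ, ‖u‖ = 1 → ∃ k, 0 < c k ⬝ᵥ u) :
    Bornology.IsBounded (polyI c d Set.univ) := by
  let f : (Fin n → ℝ) → ℝ := fun x => ∑ k, max (c k ⬝ᵥ x) 0
  have hf : Continuous f := by
    refine continuous_finsetSum _ fun k _ => ?_
    refine Continuous.max ?_ continuous_const
    unfold dotProduct
    fun_prop
  have hpos : ∀ u, ‖u‖ = 1 → 0 < f u := by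
    intro u hu
    obtain ⟨k, hk⟩ := h u hu
    refine lt_of_lt_of_le (lt_max_of_lt_left hk) (Finset.single_le_sum
      (f := fun k => max (c k ⬝ᵥ u) 0) (fun k _ => le_max_right _ _) (Finset.mem_univ k))
  have hδ : ∃ δ > 0, ∀ u, ‖u‖ = 1 → δ ≤ f u := by
    by_cases hne : (Metric.sphere (0 : Fin n → ℝ) 1).Nonempty
    · obtain ⟨u, hu, hmin⟩ := (isCompact_sphere (0 : Fin n → ℝ) 1).exists_isMinOn hne hf.continuousOn
      refine ⟨f u, hpos u (by simpa using hu), fun v hv => hmin (by simpa using hv)⟩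
    · refine ⟨1, one_pos, fun u hu => absurd ⟨u, by simpa using hu⟩ hne⟩
  obtain ⟨δ, hδ, hδf⟩ := hδ
  rw [isBounded_iff_forall_norm_le]
  refine ⟨(∑ k, max (d k) 0) / δ, fun x hx => ?_⟩
  rw [le_div_iff₀ hδ]
  have h1 : f x ≤ ∑ k, max (d k) 0 :=
    Finset.sum_le_sum fun k _ => max_le_max (hx k trivial) le_rfl
  refine le_trans ?_ h1
  by_cases hx0 : x = 0
  · subst hx0
    simp [f]
  have hn : 0 < ‖x‖ := norm_pos_iff.2 hx0
  have h2 := hδf (‖x‖⁻¹ • x) (by rw [norm_smul, norm_inv, norm_norm, inv_mul_cancel₀ hn.ne'])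
  have h3 : f x = ‖x‖ * f (‖x‖⁻¹ • x) := by
    simp only [f, Finset.mul_sum, dotProduct_smul, smul_eq_mul]
    refine Finset.sum_congr rfl fun k _ => ?_
    rw [mul_max_of_nonneg _ _ hn.le, mul_zero, mul_inv_cancel_left₀ hn.ne']
  rw [h3]
  exact mul_le_mul_of_nonneg_left h2 hn.le

lemma exp_bounded {n m : ℕ} (c : Fin m → Fin n → ℝ) (d : Fin m → ℝ)
    (hgen : ∀ i, ∀ z ∈ lat n, z ≠ 0 → c i ⬝ᵥ z ≠ 0)
    (v : Fin m → Fin n → ℝ) (hv : ∀ i, v i ∈ lat n) (hve : ∀ i, c i ⬝ᵥ v i = d i)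
    (hvs : ∀ i k, k ≠ i → c k ⬝ᵥ v i < d k)
    (hfin : {z ∈ lat n | ∀ k, c k ⬝ᵥ z < d k}.Finite) :
    Bornology.IsBounded (polyI c d Set.univ) := by
  apply bounded_of_no_rec
  intro u hu
  by_contra! hcon
  obtain ⟨R, hR⟩ := isBounded_iff_forall_norm_le.1 hfin.isBounded
  by_cases hm : m = 0
  · subst hm
    obtain ⟨z, hz, t, ht, hzt⟩ := dirichlet u 1 one_pos (max 0 (R + 2))
    have h2 : 0 ≤ t := (le_max_left _ _).trans ht
    have h3 : R + 2 ≤ t := (le_max_right _ _).trans ht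
    have h4 : t - 1 ≤ ‖z‖ := by
      have : ‖t • u‖ ≤ ‖z‖ + ‖z - t • u‖ := by
        have := norm_sub_le z (z - t • u)
        simpa using this
      rw [norm_smul, hu, Real.norm_of_nonneg h2] at this
      linarith
    have := hR z ⟨hz, fun k => k.elim0⟩
    linarith
  have hi : ∃ i, c i ⬝ᵥ u < 0 ∨ ∀ k, c k ⬝ᵥ u = 0 := by
    by_cases h : ∃ i, c i ⬝ᵥ u < 0
    · obtain ⟨i, hi⟩ := h
      exact ⟨i, Or.inl hi⟩
    · push Not at h
      exact ⟨⟨0, Nat.pos_of_ne_zero hm⟩, Or.inr fun k => le_antisymm (hcon k) (h k)⟩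
  obtain ⟨i, hi⟩ := hi
  have hε : ∃ ε > 0, ∀ k, k ≠ i → ε ≤ d k - c k ⬝ᵥ v i := by
    have : ∀ᶠ ε in nhdsWithin (0 : ℝ) (Set.Ioi 0), ∀ k, k ≠ i → ε ≤ d k - c k ⬝ᵥ v i := by
      rw [Filter.eventually_all]
      intro k
      by_cases hk : k = i
      · exact Filter.Eventually.of_forall fun _ h => absurd hk h
      · filter_upwards [Ioo_mem_nhdsGT (sub_pos.2 (hvs i k hk))] with ε h _ using h.2.le
    obtain ⟨ε, h, h'⟩ := (this.and self_mem_nhdsWithin).exists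
    exact ⟨ε, h', h⟩
  obtain ⟨ε, hε, hεk⟩ := hε
  obtain ⟨z, hz, hzT, hzi, hzk⟩ := rec_approx c hgen u hu hcon i hi ε hε (R + ‖v i‖ + 1)
  have := hR (v i + z) ⟨lat_add (hv i) hz, fun k => by
    rw [dotProduct_add]
    by_cases hk : k = i
    · subst hk
      rw [hve]; linarith
    · have := hεk k hk
      have := hzk k
      linarith⟩
  have h5 : ‖z‖ ≤ ‖v i + z‖ + ‖v i‖ := by
    have := norm_sub_le (v i + z) (v i)
    simpa using this
  linarith

lemma interior_poly {n m : ℕ} (c : Fin m → Fin n → ℝ) (d : Fin m → ℝ) (hc : ∀ i, c i ≠ 0) :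
    interior (polyI c d Set.univ) = {x | ∀ k, c k ⬝ᵥ x < d k} := by
  apply Set.Subset.antisymm
  · intro x hx k
    have hxP : ∀ᶠ y in nhds x, y ∈ polyI c d Set.univ := mem_interior_iff_mem_nhds.1 hx
    have ht : Filter.Tendsto (fun s : ℝ => x + s • c k) (nhds 0) (nhds x) := by
      have : Continuous (fun s : ℝ => x + s • c k) := by fun_prop
      simpa using this.tendsto 0
    have h1 : ∀ᶠ s in nhdsWithin (0 : ℝ) (Set.Ioi 0), x + s • c k ∈ polyI c d Set.univ :=
      (ht.eventually hxP).filter_mono nhdsWithin_le_nhds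
    obtain ⟨s, hs, hs0⟩ := (h1.and self_mem_nhdsWithin).exists
    have h2 : c k ⬝ᵥ (x + s • c k) ≤ d k := hs k trivial
    rw [dotProduct_add, dotProduct_smul, smul_eq_mul] at h2
    have h3 : 0 < c k ⬝ᵥ c k := by
      refine lt_of_le_of_ne (Finset.sum_nonneg fun j _ => mul_self_nonneg _) ?_
      intro h
      exact hc k (dotProduct_self_eq_zero.1 h.symm)
    have := mul_pos (Set.mem_Ioi.1 hs0) h3
    linarith
  · apply interior_maximal
    · intro x hx k _
      exact (hx k).le
    · rw [Set.ofPred_forall]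
      refine isOpen_iInter_of_finite fun k => isOpen_lt ?_ continuous_const
      unfold dotProduct
      fun_prop

lemma facet_mem {n m : ℕ} (c : Fin m → Fin n → ℝ) (d : Fin m → ℝ) (i : Fin m)
    (v : Fin n → ℝ) (hve : c i ⬝ᵥ v = d i) (hvs : ∀ k, k ≠ i → c k ⬝ᵥ v < d k) :
    v ∈ intrinsicInterior ℝ {x ∈ polyI c d Set.univ | ∑ j, c i j * x j = d i} := by
  set S := {x ∈ polyI c d Set.univ | ∑ j, c i j * x j = d i} with hS
  have hvS : v ∈ S := by
    refine ⟨fun k _ => ?_, hve⟩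
    by_cases hk : k = i
    · subst hk; exact hve.le
    · exact (hvs k hk).le
  have hspan : ∀ y ∈ affineSpan ℝ S, c i ⬝ᵥ y = d i := by
    intro y hy
    refine affineSpan_induction (p := fun y => c i ⬝ᵥ y = d i) hy (fun x hx => hx.2) ?_
    intro a x y z hx hy hz
    simp only [vsub_eq_sub, vadd_eq_add, dotProduct_add, dotProduct_smul, dotProduct_sub, hx, hy, hz]
    simp
  rw [mem_intrinsicInterior]
  refine ⟨⟨v, subset_affineSpan ℝ S hvS⟩, ?_, rfl⟩
  rw [mem_interior]
  refine ⟨{y | ∀ k, k ≠ i → c k ⬝ᵥ (y : Fin n → ℝ) < d k}, ?_, ?_, hvs⟩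
  · intro y hy
    refine ⟨fun k _ => ?_, hspan y y.2⟩
    by_cases hk : k = i
    · subst hk; exact (hspan y y.2).le
    · exact (hy k hk).le
  · rw [Set.ofPred_forall]
    refine isOpen_iInter_of_finite fun k => ?_
    by_cases hk : k = i
    · simp [hk]
    · simp only [ne_eq, hk, not_false_eq_true, true_imp_iff]
      refine isOpen_lt ?_ continuous_const
      have h1 : Continuous (fun x : Fin n → ℝ => c k ⬝ᵥ x) := by
        unfold dotProduct
        fun_prop
      exact h1.comp continuous_subtype_val

/-- Bell's expanding polyhedron lemma. -/
theorem stmt2 {n m : ℕ} (A : Fin m → Fin n → ℝ) (b : Fin m → ℝ)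
    (hne : (polyI A b Set.univ).Nonempty)
    (hnr : NonRedundant A b)
    (hmax : ∀ (m' : ℕ) (A' : Fin m' → Fin n → ℝ) (b' : Fin m' → ℝ),
      NonRedundant A' b' →
      intPts (polyI A' b' Set.univ) = intPts (polyI A b Set.univ) → m' ≤ m)
    (hfin : (intPts (polyI A b Set.univ)).Finite) :
    ∃ (A' : Fin m → Fin n → ℝ) (b' : Fin m → ℝ),
      -- (1) `P'` is bounded, its interior has the same integer points as `P`,
      -- and each of its `m` facets contains exactly one integer point in its
      -- relative interior;
      Bornology.IsBounded (polyI A' b' Set.univ) ∧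
      interior (polyI A' b' Set.univ) ∩ lat n = intPts (polyI A b Set.univ) ∧
      (∀ i : Fin m,
        (intrinsicInterior ℝ
            {x ∈ polyI A' b' Set.univ | ∑ j, A' i j * x j = b' i} ∩
          lat n).ncard = 1) ∧
      -- (2) `V = (P' \ P) ∩ ℤ^n` is in convex position and `|V| = m`.
      ConvexPos ((polyI A' b' Set.univ \ polyI A b Set.univ) ∩ lat n) ∧
      ((polyI A' b' Set.univ \ polyI A b Set.univ) ∩ lat n).ncard = m := by
  classical
  set X := intPts (polyI A b Set.univ) with hXdef
  -- rows exist only in positive dimension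
  have hn : ∀ _ : Fin m, n ≠ 0 := by
    intro i h0
    subst h0
    obtain ⟨p, hp⟩ := hne
    apply (hnr i).2
    rintro z ⟨_, hz⟩
    refine ⟨?_, hz⟩
    rw [Subsingleton.elim z p]
    exact hp
  -- witnesses
  have hwit : ∀ i, ∃ w ∈ lat n, (∀ k, k ≠ i → A k ⬝ᵥ w ≤ b k) ∧ b i < A i ⬝ᵥ w := by
    intro i
    obtain ⟨w, ⟨hw1, hw2⟩, hwX⟩ := Set.exists_of_ssubset (hnr i)
    refine ⟨w, hw2, fun k hk => hw1 k hk, ?_⟩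
    by_contra hcon
    apply hwX
    refine ⟨fun k _ => ?_, hw2⟩
    by_cases hk : k = i
    · subst hk; exact not_lt.1 hcon
    · exact hw1 k hk
  choose w hwl hwk hwi using hwit
  -- the box
  obtain ⟨N, hN⟩ : ∃ N : ℕ, ∀ x ∈ X ∪ Set.range w, ∀ j, |x j| ≤ N := by
    obtain ⟨R, hR⟩ := isBounded_iff_forall_norm_le.1
      (hfin.union (Set.finite_range w)).isBounded
    obtain ⟨N, hN⟩ := exists_nat_ge R
    exact ⟨N, fun x hx j => (norm_le_pi_norm x j).trans ((hR x hx).trans hN)⟩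
  set F := lat n ∩ {x | ∀ j, |x j| ≤ N} with hF
  have hFfin : F.Finite := box_finite n N
  -- generic perturbation
  choose c d hgen hcd using fun i => perturb (A i) (b i) F hFfin
  have hwF : ∀ i, w i ∈ F := fun i => ⟨hwl i, hN _ (Or.inr ⟨i, rfl⟩)⟩
  obtain ⟨d', hdd', hwit', hstr⟩ := expand F hFfin c d (fun i => ⟨w i, hwF i,
    fun k hk => (hcd k _ (hwF i)).1 (hwk i k hk), ((hcd i _ (hwF i)).2 (hwi i)).le⟩) Finset.univ
  choose v hvF hvs _ hve using hwit'
  replace hve : ∀ i, c i ⬝ᵥ v i = d' i := fun i => hve i (Finset.mem_univ i)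
  have hvl : ∀ i, v i ∈ lat n := fun i => (hvF i).1
  have hXF : ∀ z, z ∈ X ↔ z ∈ F ∧ ∀ k, c k ⬝ᵥ z < d' k := by
    intro z
    constructor
    · intro hz
      have hzF : z ∈ F := ⟨hz.2, hN _ (Or.inl hz)⟩
      exact ⟨hzF, fun k => ((hcd k z hzF).1 (hz.1 k trivial)).trans_le (hdd' k)⟩
    · rintro ⟨hzF, hz⟩
      refine ⟨fun k _ => ?_, hzF.1⟩
      have h1 := hstr z hzF hz k
      by_contra hcon
      exact absurd ((hcd k z hzF).2 (not_le.1 hcon)) (not_lt.2 h1.le)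
  -- removing the box
  have hXs : {z ∈ lat n | ∀ k, c k ⬝ᵥ z < d' k} = X := by
    apply Set.Subset.antisymm
    · rintro z ⟨hzl, hz⟩
      have hd2 : ∀ k, ∃ e : ℝ, e < d' k ∧ c k ⬝ᵥ z ≤ e ∧ ∀ y ∈ F, c k ⬝ᵥ y < d' k → c k ⬝ᵥ y ≤ e := by
        intro k
        obtain ⟨y, ⟨_, hy⟩, hymax⟩ := Set.exists_max_image
          {y ∈ insert z F | c k ⬝ᵥ y < d' k} (fun y => c k ⬝ᵥ y)
          ((hFfin.insert z).subset (Set.sep_subset _ _)) ⟨z, Set.mem_insert _ _, hz k⟩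
        exact ⟨c k ⬝ᵥ y, hy, hymax z ⟨Set.mem_insert _ _, hz k⟩,
          fun y' hy' h => hymax y' ⟨Set.mem_insert_of_mem _ hy', h⟩⟩
      choose e he hez heF using hd2
      let C : Fin m ⊕ (Fin n ⊕ Fin n) → Fin n → ℝ :=
        Sum.elim c (Sum.elim (fun j => Pi.single j 1) (fun j => -Pi.single j 1))
      let E : Fin m ⊕ (Fin n ⊕ Fin n) → ℝ := Sum.elim e (fun _ => (N : ℝ))
      have hbox : ∀ y : Fin n → ℝ, (∀ q : Fin n ⊕ Fin n, C (Sum.inr q) ⬝ᵥ y ≤ E (Sum.inr q)) ↔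
          ∀ j, |y j| ≤ N := by
        intro y
        constructor
        · intro h j
          have h1 := h (Sum.inl j)
          have h2 := h (Sum.inr j)
          simp [C, E] at h1 h2
          exact abs_le.2 ⟨by linarith, h1⟩
        · rintro h (j | j)
          · have := (abs_le.1 (h j)).2
            simpa [C, E] using this
          · have := (abs_le.1 (h j)).1
            simp [C, E]
            linarith
      have hpts : {y ∈ lat n | ∀ q, C q ⬝ᵥ y ≤ E q} = X := by
        ext y
        rw [hXF]
        constructor
        · rintro ⟨hyl, hy⟩
          exact ⟨⟨hyl, (hbox y).1 fun q => hy _⟩, fun k => (hy (Sum.inl k)).trans_lt (he k)⟩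
        · rintro ⟨hyF, hy⟩
          refine ⟨hyF.1, ?_⟩
          rintro (k | q)
          · exact heF k y hyF (hy k)
          · exact (hbox y).2 hyF.2 q
      have := remove X hmax C E hpts (Finset.univ.map Function.Embedding.inl) (by simp) (by
        intro q hq
        obtain ⟨i, -, rfl⟩ := Finset.mem_map.1 hq
        refine ⟨v i, hvl i, ?_, ?_⟩
        · intro h
          exact absurd (((hXF _).1 h).2 i) (by rw [hve]; exact lt_irrefl _)
        · rintro (k | q) hk
          · refine heF k _ (hvF i) (hvs i k ?_)
            rintro rfl
            exact hk rfl
          · exact (hbox _).2 (hvF i).2 q)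
      rw [← this]
      refine ⟨hzl, fun q hq => ?_⟩
      obtain ⟨i, -, rfl⟩ := Finset.mem_map.1 hq
      exact hez i
    · intro z hz
      exact ⟨hz.2, ((hXF z).1 hz).2⟩
  have hc0 : ∀ i, c i ≠ 0 := by
    intro i h
    have hpos := Nat.pos_of_ne_zero (hn i)
    refine hgen i (fun _ => 1) (fun j => ⟨1, by simp⟩) ?_ (by simp [h])
    intro h1
    have := congrFun h1 ⟨0, hpos⟩
    simp at this
  have huniq : ∀ i, ∀ z ∈ lat n, c i ⬝ᵥ z = d' i → z = v i := by
    intro i z hz h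
    by_contra hne'
    apply hgen i (z - v i) (lat_sub hz (hvl i)) (sub_ne_zero.2 hne')
    rw [dotProduct_sub, h, hve, sub_self]
  have hvP : ∀ i, v i ∈ polyI c d' Set.univ := by
    intro i k _
    by_cases hk : k = i
    · subst hk; exact (hve k).le
    · exact (hvs i k hk).le
  have hvX : ∀ i, v i ∉ X := by
    intro i h
    have := ((hXF _).1 h).2 i
    rw [hve] at this
    exact lt_irrefl _ this
  have hV : (polyI c d' Set.univ \ polyI A b Set.univ) ∩ lat n = Set.range v := by
    ext z
    constructor
    · rintro ⟨⟨hz1, hz2⟩, hzl⟩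
      by_cases h : ∀ k, c k ⬝ᵥ z < d' k
      · have : z ∈ X := by rw [← hXs]; exact ⟨hzl, h⟩
        exact absurd this.1 hz2
      · push Not at h
        obtain ⟨k, hk⟩ := h
        exact ⟨k, (huniq k z hzl (le_antisymm (hz1 k trivial) hk)).symm⟩
    · rintro ⟨i, rfl⟩
      exact ⟨⟨hvP i, fun h => hvX i ⟨h, hvl i⟩⟩, hvl i⟩
  have hinj : Function.Injective v := by
    intro i k h
    by_contra hik
    have := hvs k i hik
    rw [← h, hve] at this
    exact lt_irrefl _ this
  refine ⟨c, d', ?_, ?_, ?_, ?_, ?_⟩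
  · exact exp_bounded c d' hgen v hvl hve hvs (by rw [hXs]; exact hfin)
  · rw [interior_poly c d' hc0, ← hXs]
    ext z
    exact and_comm
  · intro i
    rw [Set.ncard_eq_one]
    refine ⟨v i, ?_⟩
    ext z
    constructor
    · rintro ⟨hz, hzl⟩
      exact huniq i z hzl (intrinsicInterior_subset hz).2
    · rintro rfl
      exact ⟨facet_mem c d' i _ (hve i) (hvs i), hvl i⟩
  · rw [hV]
    rintro _ ⟨i, rfl⟩ hmem
    have hconv : Convex ℝ {x : Fin n → ℝ | c i ⬝ᵥ x < d' i} :=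
      convex_halfSpace_lt ⟨fun x y => dotProduct_add _ _ _, fun r x => dotProduct_smul _ _ _⟩ _
    have : v i ∈ {x : Fin n → ℝ | c i ⬝ᵥ x < d' i} := by
      refine convexHull_min ?_ hconv hmem
      rintro _ ⟨⟨k, rfl⟩, hk⟩
      refine hvs k i ?_
      rintro rfl
      exact hk rfl
    have h : c i ⬝ᵥ v i < d' i := this
    rw [hve] at h
    exact lt_irrefl _ h
  · rw [hV, ← Set.image_univ, Set.ncard_image_of_injective _ hinj, Set.ncard_univ]
    simp
end
end

section
/- For all integers n ≥ 1 and k ≥ 0, c(n,k) ≤ ℓ(n,k+1) − 1. -/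
open Pointwise

noncomputable section

theorem lat_inter_hull_finite {n : ℕ} (V : Set (Fin n → ℝ)) (hV : V.Finite) : (iconv V).Finite := by
  have hb : Bornology.IsBounded (convexHull ℝ V) := isBounded_convexHull.2 hV.isBounded
  obtain ⟨R, hR⟩ := hb.exists_norm_le
  have hfin : (Set.Icc (fun _ : Fin n => -⌈R⌉) (fun _ : Fin n => ⌈R⌉)).Finite := Set.finite_Icc _ _
  refine (hfin.image (fun (z : Fin n → ℤ) (j : Fin n) => (z j : ℝ))).subset ?_
  rintro x ⟨hx, hl⟩
  choose z hz using hl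
  have hj : ∀ j, |(z j : ℝ)| ≤ ⌈R⌉ := fun j => by
    rw [← hz j]
    exact ((norm_le_pi_norm x j).trans (hR x hx)).trans (Int.le_ceil R)
  refine ⟨z, ⟨fun j => ?_, fun j => ?_⟩, ?_⟩
  · have := (abs_le.1 (hj j)).1
    exact_mod_cast this
  · have := (abs_le.1 (hj j)).2
    exact_mod_cast this
  · funext j
    exact (hz j).symm

theorem combi {ι α : Type*} [DecidableEq ι] (I : Finset ι) (Z : Finset α) (S : Set α)
    (f : ι → α → ℝ) (b : ι → ℝ) (v : ι → α)
    (hS : ∀ z ∈ Z, (∀ i ∈ I, f i z ≤ b i) → z ∈ S)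
    (hvZ : ∀ i ∈ I, v i ∈ Z) (hv : ∀ i ∈ I, b i < f i (v i))
    (hv' : ∀ i ∈ I, ∀ j ∈ I, j ≠ i → f j (v i) ≤ b j) :
    ∃ (β : ι → ℝ) (w : ι → α),
      (∀ z ∈ Z, (∀ i ∈ I, f i z < β i) → z ∈ S) ∧
      (∀ i ∈ I, w i ∈ Z ∧ f i (w i) = β i ∧ ∀ j ∈ I, j ≠ i → f j (w i) < β j) := by
  have key : ∀ T : Finset ι, T ⊆ I → ∃ (β : ι → ℝ) (w : ι → α),
      (∀ z ∈ Z, (∀ i ∈ I, f i z < β i) → z ∈ S) ∧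
      (∀ i ∈ I, w i ∈ Z ∧ β i ≤ f i (w i) ∧ ∀ j ∈ I, j ≠ i → f j (w i) < β j) ∧
      (∀ i ∈ T, f i (w i) = β i) := by
    intro T
    induction T using Finset.induction_on with
    | empty =>
      intro _
      have h0 : ∀ i, ∃ c : ℝ, i ∈ I → (b i < c ∧ c ≤ f i (v i) ∧ ∀ z ∈ Z, f i z < c → f i z ≤ b i) := by
        intro i
        by_cases hi : i ∈ I
        · obtain ⟨z, hz, hmin⟩ := Finset.exists_min_image (Z.filter (fun z => b i < f i z)) (f i)
            ⟨v i, Finset.mem_filter.2 ⟨hvZ i hi, hv i hi⟩⟩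
          refine ⟨f i z, fun _ => ⟨(Finset.mem_filter.1 hz).2,
            hmin _ (Finset.mem_filter.2 ⟨hvZ i hi, hv i hi⟩), ?_⟩⟩
          intro y hy hlt
          by_contra hcon
          exact absurd (hmin y (Finset.mem_filter.2 ⟨hy, not_le.1 hcon⟩)) (not_le.2 hlt)
        · exact ⟨0, fun h => absurd h hi⟩
      choose β hβ using h0
      refine ⟨β, v, ?_, ?_, by simp⟩
      · intro z hz h
        exact hS z hz fun i hi => (hβ i hi).2.2 z hz (h i hi)
      · intro i hi
        exact ⟨hvZ i hi, (hβ i hi).2.1, fun j hj hji => (hv' i hi j hj hji).trans_lt (hβ j hj).1⟩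
    | insert a T haT ih =>
      intro hT
      obtain ⟨β, w, h1, h2, h3⟩ := ih ((Finset.subset_insert _ _).trans hT)
      have ha : a ∈ I := hT (Finset.mem_insert_self _ _)
      obtain ⟨y, hy, hmin⟩ := Finset.exists_min_image
        (Z.filter (fun z => β a ≤ f a z ∧ ∀ j ∈ I, j ≠ a → f j z < β j)) (f a)
        ⟨w a, Finset.mem_filter.2 (h2 a ha)⟩
      obtain ⟨hyZ, hya, hyj⟩ := Finset.mem_filter.1 hy
      refine ⟨Function.update β a (f a y), Function.update w a y, ?_, ?_, ?_⟩
      · intro z hz h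
        have hne : ∀ j ∈ I, j ≠ a → f j z < β j := fun j hj hja => by
          have := h j hj
          rwa [Function.update_of_ne hja] at this
        have hza : f a z < f a y := by
          have := h a ha
          rwa [Function.update_self] at this
        refine h1 z hz fun i hi => ?_
        by_cases hia : i = a
        · subst hia
          by_contra hcon
          exact absurd (hmin z (Finset.mem_filter.2 ⟨hz, not_lt.1 hcon, hne⟩)) (not_le.2 hza)
        · exact hne i hi hia
      · intro i hi
        by_cases hia : i = a
        · subst hia
          simp only [Function.update_self]
          refine ⟨hyZ, le_refl _, fun j hj hji => ?_⟩
          rw [Function.update_of_ne hji]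
          exact hyj j hj hji
        · simp only [Function.update_of_ne hia]
          obtain ⟨p, q, r⟩ := h2 i hi
          refine ⟨p, q, fun j hj hji => ?_⟩
          by_cases hja : j = a
          · subst hja
            rw [Function.update_self]
            exact (r j hj hji).trans_le hya
          · rw [Function.update_of_ne hja]
            exact r j hj hji
      · intro i hi
        by_cases hia : i = a
        · subst hia
          simp
        · simp only [Function.update_of_ne hia]
          exact h3 i (Finset.mem_of_mem_insert_of_ne hi hia)
  obtain ⟨β, w, h1, h2, h3⟩ := key I (Finset.Subset.refl _)
  exact ⟨β, w, h1, fun i hi => ⟨(h2 i hi).1, h3 i hi, (h2 i hi).2.2⟩⟩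

/-- An open half-space together with one boundary point is convex. -/
theorem convex_half_insert {n : ℕ} (L : (Fin n → ℝ) →ₗ[ℝ] ℝ) (w : Fin n → ℝ) :
    Convex ℝ {x | L x < L w ∨ x = w} := by
  intro x hx y hy s t hs ht hst
  rcases hs.eq_or_lt with rfl | hs
  · have : t = 1 := by linarith
    subst this
    simpa using hy
  rcases ht.eq_or_lt with rfl | ht
  · have : s = 1 := by linarith
    subst this
    simpa using hx
  have e : L w = s * L w + t * L w := by rw [← add_mul, hst, one_mul]
  rcases hx with hx | rfl
  · left
    have hy' : L y ≤ L w := by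
      rcases hy with hy | rfl
      · exact hy.le
      · exact le_refl _
    simp only [map_add, map_smul, smul_eq_mul]
    nlinarith
  · rcases hy with hy | rfl
    · left
      simp only [map_add, map_smul, smul_eq_mul]
      nlinarith
    · right
      rw [← add_smul, hst, one_smul]

theorem ell_set_nonempty (n k : ℕ) :
    ∃ s, ∀ V : Set (Fin n → ℝ), V ⊆ lat n → ConvexPos V → V.Finite →
      V.ncard = s → k + 1 ≤ (iconv V \ V).ncard := by
  classical
  refine ⟨2 ^ n * (k + 1) + 1, fun V hl hc hf hs => ?_⟩
  have hl' : ∀ x : Fin n → ℝ, ∃ z : Fin n → ℤ, x ∈ V → ∀ j, x j = z j := by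
    intro x
    by_cases hx : x ∈ V
    · choose z hz using hl hx
      exact ⟨z, fun _ => hz⟩
    · exact ⟨0, fun h => absurd h hx⟩
  choose z hz using hl'
  obtain ⟨p, -, hp⟩ := Finset.exists_lt_card_fiber_of_mul_lt_card_of_maps_to
    (s := hf.toFinset) (t := (Finset.univ : Finset (Fin n → ZMod 2))) (n := k + 1)
    (f := fun x j => (z x j : ZMod 2)) (fun _ _ => Finset.mem_univ _) (by
      rw [← Set.ncard_eq_toFinset_card V hf, hs]
      simp)
  set F := hf.toFinset.filter (fun x => (fun j => (z x j : ZMod 2)) = p) with hF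
  have hFne : F.Nonempty := Finset.card_pos.1 (by omega)
  obtain ⟨x, hx⟩ := hFne
  have hcard : k + 1 ≤ (F.erase x).card := by
    rw [Finset.card_erase_of_mem hx]
    omega
  have hFV : ∀ y ∈ F, y ∈ V := fun y hy => hf.mem_toFinset.1 (Finset.mem_filter.1 hy).1
  let g : (Fin n → ℝ) → (Fin n → ℝ) := fun y => (1 / 2 : ℝ) • x + (1 / 2 : ℝ) • y
  have hg : Function.Injective g := by
    intro a b hab
    have h2 : (1 / 2 : ℝ) • a = (1 / 2 : ℝ) • b := add_left_cancel hab
    exact smul_right_injective _ (by norm_num : (1 / 2 : ℝ) ≠ 0) h2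
  rw [← Finset.card_image_of_injective _ hg, ← Set.ncard_coe_finset] at hcard
  refine hcard.trans (Set.ncard_le_ncard ?_ ((lat_inter_hull_finite V hf).sdiff))
  intro m hm
  obtain ⟨y, hy, rfl⟩ := Finset.mem_image.1 (Finset.mem_coe.1 hm)
  obtain ⟨hyx, hyF⟩ := Finset.mem_erase.1 hy
  have hxV := hFV x hx
  have hyV := hFV y hyF
  have hmem : ∀ W : Set (Fin n → ℝ), x ∈ W → y ∈ W → g y ∈ convexHull ℝ W := fun W h1 h2 =>
    (convex_convexHull ℝ W) (subset_convexHull ℝ W h1) (subset_convexHull ℝ W h2)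
      (by norm_num) (by norm_num) (by norm_num)
  refine ⟨⟨hmem V hxV hyV, ?_⟩, ?_⟩
  · intro j
    have e1 := congrFun (Finset.mem_filter.1 hx).2 j
    have e2 := congrFun (Finset.mem_filter.1 hyF).2 j
    have e3 : ((z x j + z y j : ℤ) : ZMod 2) = 0 := by
      push_cast
      rw [e1, e2]
      exact CharTwo.add_self_eq_zero _
    rw [ZMod.intCast_zmod_eq_zero_iff_dvd] at e3
    obtain ⟨c, hc⟩ := e3
    refine ⟨c, ?_⟩
    have hc' : (z x j : ℝ) + z y j = 2 * c := by exact_mod_cast hc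
    simp only [g, Pi.add_apply, Pi.smul_apply, smul_eq_mul]
    rw [hz x hxV j, hz y hyV j]
    linarith
  · intro hgV
    refine hc _ hgV (hmem _ ⟨hxV, ?_⟩ ⟨hyV, ?_⟩)
    · intro h
      apply hyx
      funext j
      have := congrFun (Set.mem_singleton_iff.1 h) j
      simp only [g, Pi.add_apply, Pi.smul_apply, smul_eq_mul] at this
      linarith
    · intro h
      apply hyx
      funext j
      have := congrFun (Set.mem_singleton_iff.1 h) j
      simp only [g, Pi.add_apply, Pi.smul_apply, smul_eq_mul] at this
      linarith

theorem helly_of_ell (n k s : ℕ)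
    (hs : ∀ V : Set (Fin n → ℝ), V ⊆ lat n → ConvexPos V → V.Finite →
      V.ncard = s → k + 1 ≤ (iconv V \ V).ncard) : HellyBound n k (s - 1) := by
  classical
  intro m A b hfin hk
  have hs0 : 1 ≤ s := by
    by_contra h
    have h0 : s = 0 := by omega
    have := hs ∅ (Set.empty_subset _) (fun v hv => absurd hv (Set.notMem_empty v))
      Set.finite_empty (by simp [h0])
    simp [iconv] at this
  set S := intPts (polyI A b Set.univ) with hSdef
  obtain ⟨I, hI, hImin⟩ := Finset.exists_min_image
    ((Finset.univ : Finset (Finset (Fin m))).filter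
      (fun I : Finset (Fin m) => intPts (polyI A b (↑I : Set (Fin m))) = S)) Finset.card
    ⟨Finset.univ, by simp [hSdef]⟩
  have hIS := (Finset.mem_filter.1 hI).2
  refine ⟨I, ?_, hIS⟩
  by_contra hcon
  have hsI : s ≤ I.card := by omega
  obtain ⟨J, hJI, hJ⟩ := Finset.exists_subset_card_eq hsI
  let L : Fin m → (Fin n → ℝ) →ₗ[ℝ] ℝ := fun i => ∑ j, A i j • LinearMap.proj j
  have hL : ∀ i x, L i x = ∑ j, A i j * x j := by
    intro i x
    simp [L]
  have hv : ∀ i, ∃ v : Fin n → ℝ, i ∈ I →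
      v ∈ lat n ∧ b i < L i v ∧ ∀ j ∈ I, j ≠ i → L j v ≤ b j := by
    intro i
    by_cases hi : i ∈ I
    · by_contra hno
      push Not at hno
      have hlt := Finset.card_erase_lt_of_mem hi
      refine absurd (hImin (I.erase i) (Finset.mem_filter.2 ⟨Finset.mem_univ _, ?_⟩)) (not_le.2 hlt)
      rw [← hIS]
      ext x
      constructor
      · rintro ⟨hx, hxl⟩
        have hxe : ∀ j ∈ I, j ≠ i → L j x ≤ b j := fun j hj hji => by
          rw [hL]
          exact hx j (Finset.mem_coe.2 (Finset.mem_erase.2 ⟨hji, hj⟩))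
        refine ⟨fun j hj => ?_, hxl⟩
        rw [← hL]
        by_cases hji : j = i
        · subst hji
          by_contra hgt
          obtain ⟨-, h⟩ := hno x
          obtain ⟨j', h1, h2, h3⟩ := h hxl (not_le.1 hgt)
          exact absurd (hxe j' h1 h2) (not_le.2 h3)
        · exact hxe j hj hji
      · rintro ⟨hx, hxl⟩
        exact ⟨fun j hj => hx j (Finset.mem_coe.2 (Finset.mem_of_mem_erase (Finset.mem_coe.1 hj))), hxl⟩
    · exact ⟨0, fun h => absurd h hi⟩
  choose v hv using hv
  have hv0fin : (v '' (I : Set (Fin m))).Finite := I.finite_toSet.image v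
  have hZfin := lat_inter_hull_finite _ hv0fin
  obtain ⟨β, w, h1, h2⟩ := combi I hZfin.toFinset S (fun i x => L i x) b v
    (by
      intro z hz h
      rw [← hIS]
      refine ⟨fun i hi => ?_, (hZfin.mem_toFinset.1 hz).2⟩
      rw [← hL]
      exact h i hi)
    (fun i hi => hZfin.mem_toFinset.2
      ⟨subset_convexHull ℝ _ ⟨i, hi, rfl⟩, (hv i hi).1⟩)
    (fun i hi => (hv i hi).2.1) (fun i hi => (hv i hi).2.2)
  have hwZ : ∀ i ∈ I, w i ∈ iconv (v '' (I : Set (Fin m))) := fun i hi =>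
    hZfin.mem_toFinset.1 (h2 i hi).1
  have hwinj : Set.InjOn w (J : Set (Fin m)) := by
    intro i hi j hj hij
    by_contra hne
    have a1 := (h2 i (hJI hi)).2.1
    have a2 := (h2 j (hJI hj)).2.2 i (hJI hi) hne
    rw [← hij] at a2
    exact absurd a1 a2.ne
  have hVfin : (w '' (J : Set (Fin m))).Finite := J.finite_toSet.image w
  have hle := hs (w '' (J : Set (Fin m))) (by
      rintro _ ⟨i, hi, rfl⟩
      exact (hwZ i (hJI hi)).2) (by
      rintro _ ⟨i, hi, rfl⟩ hmem
      have hsub : convexHull ℝ (w '' (J : Set (Fin m)) \ {w i}) ⊆ {x | L i x < β i} := by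
        refine convexHull_min ?_ (convex_halfSpace_lt (L i).isLinear _)
        rintro _ ⟨⟨j, hj, rfl⟩, hne⟩
        refine (h2 j (hJI hj)).2.2 i (hJI hi) ?_
        rintro rfl
        exact hne rfl
      exact absurd (h2 i (hJI hi)).2.1 (hsub hmem).ne) hVfin (by
      rw [Set.ncard_image_of_injOn hwinj, Set.ncard_coe_finset, hJ])
  have hsub : iconv (w '' (J : Set (Fin m))) \ (w '' (J : Set (Fin m))) ⊆ S := by
    rintro x ⟨⟨hx, hxl⟩, hxV⟩
    refine h1 x (hZfin.mem_toFinset.2 ⟨?_, hxl⟩) ?_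
    · refine convexHull_min ?_ (convex_convexHull ℝ _) hx
      rintro _ ⟨i, hi, rfl⟩
      exact (hwZ i (hJI hi)).1
    · intro i hi
      by_cases hiJ : i ∈ J
      · have : x ∈ {x | L i x < L i (w i) ∨ x = w i} := by
          refine convexHull_min ?_ (convex_half_insert (L i) (w i)) hx
          rintro _ ⟨j, hj, rfl⟩
          by_cases hij : i = j
          · subst hij
            exact Or.inr rfl
          · left
            have := (h2 j (hJI hj)).2.2 i hi hij
            have e := (h2 i hi).2.1
            rw [e]
            exact this
        rcases this with h | h
        · have e := (h2 i hi).2.1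
          rw [← e]
          exact h
        · exact absurd ⟨i, hiJ, h.symm⟩ hxV
      · have : convexHull ℝ (w '' (J : Set (Fin m))) ⊆ {x | L i x < β i} := by
          refine convexHull_min ?_ (convex_halfSpace_lt (L i).isLinear _)
          rintro _ ⟨j, hj, rfl⟩
          refine (h2 j (hJI hj)).2.2 i hi ?_
          rintro rfl
          exact hiJ hj
        exact this hx
  have := Set.ncard_le_ncard hsub hfin
  omega

/-- `c(n,k) ≤ ℓ(n,k+1) − 1`. -/
theorem stmt3 (n k : ℕ) (hn : 1 ≤ n) : cnk n k ≤ ellnk n (k + 1) - 1 := by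
  refine Nat.sInf_le ?_
  exact helly_of_ell n k _ (Nat.sInf_mem (ell_set_nonempty n k))
end
end
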